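/- For every point [a+b] in σ_2°(S_N^+) \ S_N^+ (i.e., a point on a bisecant line with d([a],[b]) ≥ 2, not a pure spinor), the isotropic kernel of a+b equals the intersection of the kernels: H_{a+b} = H_a ∩ H_b. Consequently, if [a+b] = [c+d] for pure spinors a,b,c,d, then d([a],[b]) = d([c],[d]). -/

import Mathlib

/- Formalization of a statement about spinor varieties (Galgano, arXiv:2302.05295). -/

noncomputable section
open CliffordAlgebra

/-- The model for the maximal isotropic subspace `E`. -/
abbrev Evec (N : ℕ) := Fin N → ℂ

/-- The model for `V = E ⊕ E^∨`: a pair `(e, f)` represents `∑ eᵢ • eᵢ + ∑ fᵢ • fᵢ`. -/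
abbrev Vsp (N : ℕ) := (Fin N → ℂ) × (Fin N → ℂ)

/-- The exterior algebra `⋀ E` hosting the (sums of half-) spin representations. -/
abbrev ExtE (N : ℕ) := ExteriorAlgebra ℂ (Evec N)

/-- `b ↦ (a ↦ ∑ aᵢ bᵢ)`, identifying `E` with its dual. -/
def toDualMap (N : ℕ) : Evec N →ₗ[ℂ] Module.Dual ℂ (Evec N) where
  toFun b := ∑ i, b i • LinearMap.proj i
  map_add' x y := by simp [add_smul, Finset.sum_add_distrib]
  map_smul' c x := by simp [smul_smul, Finset.smul_sum]

/-- Clifford multiplication on the spinor module `⋀E` by an element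
`v = (e, f) ∈ V = E ⊕ E^∨`: wedge by `e` plus contraction by `f`; bundled as a
linear map in `v`, for a fixed spinor `x`.  `psi x v = v ⋅ x`. -/
def psi {N : ℕ} (x : ExtE N) : Vsp N →ₗ[ℂ] ExtE N :=
  (LinearMap.mulRight ℂ x).comp ((ExteriorAlgebra.ι ℂ).comp (LinearMap.fst ℂ _ _)) +
  ((CliffordAlgebra.contractLeft (Q := (0 : QuadraticForm ℂ (Evec N)))).flip x).comp
    ((toDualMap N).comp (LinearMap.snd ℂ _ _))

/-- The even part `⋀^{ev} E` of the exterior algebra (one half-spin representation). -/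
def evenPart (N : ℕ) : Submodule ℂ (ExtE N) :=
  CliffordAlgebra.evenOdd (0 : QuadraticForm ℂ (Evec N)) 0

/-- The odd part `⋀^{od} E` of the exterior algebra (the other half-spin representation). -/
def oddPart (N : ℕ) : Submodule ℂ (ExtE N) :=
  CliffordAlgebra.evenOdd (0 : QuadraticForm ℂ (Evec N)) 1

/-- A (representative of a) pure spinor of the even half-spin representation:
a nonzero even spinor whose isotropic annihilator `H_a = ker ψ_a` is maximal,
of dimension `N`. -/
def purespinor {N : ℕ} (a : ExtE N) : Prop :=
  a ≠ 0 ∧ a ∈ evenPart N ∧ Module.finrank ℂ (LinearMap.ker (psi a)) = N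

/-- The spinor variety `S_N^+`, as a set of points of the projective space
`ℙ(⋀^{ev}E) ⊆ ℙ(⋀E)`. -/
def SpinorVariety (N : ℕ) : Set (Projectivization ℂ (ExtE N)) :=
  {p | ∃ (a : ExtE N) (h : a ≠ 0), purespinor a ∧ p = Projectivization.mk ℂ a h}

/-- The projective line through `p` and `q` is contained in `X`. -/
def lineIn {K V : Type*} [DivisionRing K] [AddCommGroup V] [Module K V]
    (X : Set (Projectivization K V)) (p q : Projectivization K V) : Prop :=
  ∀ r : Projectivization K V, r.submodule ≤ p.submodule ⊔ q.submodule → r ∈ X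

/-- There is a chain of `r` lines inside `X` connecting `p` to `q`. -/
def chainDist {K V : Type*} [DivisionRing K] [AddCommGroup V] [Module K V]
    (X : Set (Projectivization K V)) (p q : Projectivization K V) (r : ℕ) : Prop :=
  ∃ c : ℕ → Projectivization K V, c 0 = p ∧ c r = q ∧ (∀ i ≤ r, c i ∈ X) ∧
    ∀ i < r, lineIn X (c i) (c (i + 1))

/-- The Hamming distance on `X`: the minimal number of lines inside `X` needed to
connect `p` to `q`. -/
def hdist {K V : Type*} [DivisionRing K] [AddCommGroup V] [Module K V]
    (X : Set (Projectivization K V)) (p q : Projectivization K V) : ℕ :=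
  sInf {r | chainDist X p q r}

/-- The symmetric bilinear form on `V = E ⊕ E^∨` polarising `(e, f) ↦ ∑ eᵢ fᵢ`. -/
def pairing (N : ℕ) : LinearMap.BilinForm ℂ (Vsp N) :=
  LinearMap.mk₂ ℂ (fun v w => v.1 ⬝ᵥ w.2 + w.1 ⬝ᵥ v.2)
    (fun u v w => by simp only [Prod.fst_add, Prod.snd_add, add_dotProduct, dotProduct_add]; ring)
    (fun c v w => by
      simp only [Prod.smul_fst, Prod.smul_snd, smul_dotProduct, dotProduct_smul, smul_add])
    (fun u v w => by simp only [Prod.fst_add, Prod.snd_add, add_dotProduct, dotProduct_add]; ring)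
    (fun c v w => by
      simp only [Prod.smul_fst, Prod.smul_snd, smul_dotProduct, dotProduct_smul, smul_add])

section Clifford

variable {N : ℕ}

lemma pairing_apply (v w : Vsp N) : pairing N v w = v.1 ⬝ᵥ w.2 + w.1 ⬝ᵥ v.2 := rfl

lemma pairing_comm (v w : Vsp N) : pairing N v w = pairing N w v := by
  rw [pairing_apply, pairing_apply, add_comm]

lemma toDualMap_apply (f e : Evec N) : toDualMap N f e = e ⬝ᵥ f := by
  simp [toDualMap, dotProduct, mul_comm]

lemma psi_apply (x : ExtE N) (v : Vsp N) :
    psi x v = ExteriorAlgebra.ι ℂ v.1 * x +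
      contractLeft (Q := (0 : QuadraticForm ℂ (Evec N))) (toDualMap N v.2) x := rfl

lemma psi_add (x y : ExtE N) (v : Vsp N) : psi (x + y) v = psi x v + psi y v := by
  simp only [psi_apply, mul_add, map_add]; abel

lemma psi_smul (c : ℂ) (x : ExtE N) (v : Vsp N) : psi (c • x) v = c • psi x v := by
  simp only [psi_apply, mul_smul_comm, map_smul, smul_add]

lemma psi_neg (x : ExtE N) (v : Vsp N) : psi (-x) v = -psi x v := by
  rw [← neg_one_smul ℂ, psi_smul, neg_one_smul]

lemma psi_zero (v : Vsp N) : psi (0 : ExtE N) v = 0 := by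
  simpa using psi_smul (0 : ℂ) (0 : ExtE N) v

lemma ι_mul_contractLeft (e : Evec N) (d : Module.Dual ℂ (Evec N)) (x : ExtE N) :
    contractLeft (Q := (0 : QuadraticForm ℂ (Evec N))) d (ExteriorAlgebra.ι ℂ e * x) =
      d e • x - ExteriorAlgebra.ι ℂ e * contractLeft (Q := (0 : QuadraticForm ℂ (Evec N))) d x :=
  contractLeft_ι_mul d e x

/-- The Clifford relation on spinors. -/
lemma psi_psi_add_psi_psi (x : ExtE N) (u v : Vsp N) :
    psi (psi x v) u + psi (psi x u) v = pairing N u v • x := by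
  have hι : ExteriorAlgebra.ι ℂ u.1 * ExteriorAlgebra.ι ℂ v.1 * x =
      -(ExteriorAlgebra.ι ℂ v.1 * ExteriorAlgebra.ι ℂ u.1 * x) := by
    rw [← neg_mul, eq_neg_of_add_eq_zero_left (ExteriorAlgebra.ι_add_mul_swap u.1 v.1)]
  have hc := contractLeft_comm (Q := (0 : QuadraticForm ℂ (Evec N))) (d := toDualMap N u.2)
    (d' := toDualMap N v.2) x
  simp only [psi_apply, mul_add, map_add, ι_mul_contractLeft, ← mul_assoc, hι, hc,
    toDualMap_apply, pairing_apply, add_smul]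
  abel

lemma psi_psi_self_of_isotropic (x : ExtE N) {v : Vsp N} (hv : pairing N v v = 0) :
    psi (psi x v) v = 0 := by
  have h := psi_psi_add_psi_psi x v v
  rw [hv, zero_smul, ← two_smul ℂ] at h
  exact (smul_eq_zero.1 h).resolve_left two_ne_zero

lemma psi_psi_of_mem_ker {x : ExtE N} {u : Vsp N} (hu : u ∈ LinearMap.ker (psi x)) (v : Vsp N) :
    psi (psi x v) u = pairing N u v • x := by
  have h := psi_psi_add_psi_psi x u v
  rwa [LinearMap.mem_ker.1 hu, psi_zero, add_zero] at h

lemma pairing_eq_zero_of_mem_ker {x : ExtE N} (hx : x ≠ 0) {u v : Vsp N}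
    (hu : u ∈ LinearMap.ker (psi x)) (hv : v ∈ LinearMap.ker (psi x)) : pairing N u v = 0 := by
  have h := psi_psi_of_mem_ker hu v
  rw [LinearMap.mem_ker.1 hv, psi_zero] at h
  exact (smul_eq_zero.1 h.symm).resolve_right hx

lemma ker_psi_smul {c : ℂ} (hc : c ≠ 0) (x : ExtE N) :
    LinearMap.ker (psi (c • x)) = LinearMap.ker (psi x) := by
  ext v
  simp [psi_smul, hc]

lemma pairing_nondegenerate : (pairing N).Nondegenerate := by
  have hl : ∀ v : Vsp N, (∀ w, pairing N v w = 0) → v = 0 := by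
    intro v h
    refine Prod.ext (funext fun i => ?_) (funext fun i => ?_)
    · simpa [pairing_apply] using h (0, Pi.single i 1)
    · simpa [pairing_apply] using h (Pi.single i 1, 0)
  exact ⟨hl, fun v h => hl v fun w => by rw [pairing_comm]; exact h w⟩

/-- A nonzero spinor whose annihilator in `V` is maximal isotropic (of either parity). -/
def IsPure (x : ExtE N) : Prop :=
  x ≠ 0 ∧ Module.finrank ℂ (LinearMap.ker (psi x)) = N

lemma purespinor.isPure {a : ExtE N} (ha : purespinor a) : IsPure a := ⟨ha.1, ha.2.2⟩

lemma finrank_ker_psi_le {x : ExtE N} (hx : x ≠ 0) :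
    Module.finrank ℂ (LinearMap.ker (psi x)) ≤ N := by
  have hle : LinearMap.ker (psi x) ≤ (pairing N).orthogonal (LinearMap.ker (psi x)) :=
    fun v hv u hu => pairing_eq_zero_of_mem_ker hx hu hv
  have h := Submodule.finrank_mono hle
  rw [LinearMap.BilinForm.finrank_orthogonal pairing_nondegenerate] at h
  have hV : Module.finrank ℂ (Vsp N) = N + N := by simp
  omega

lemma IsPure.exists_pairing_ne_zero {x : ExtE N} (hx : IsPure x) {v : Vsp N}
    (hv : psi x v ≠ 0) : ∃ u ∈ LinearMap.ker (psi x), pairing N u v ≠ 0 := by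
  by_contra! h
  have hle : LinearMap.ker (psi x) ≤ (pairing N).orthogonal (LinearMap.ker (psi x)) :=
    fun v hv u hu => pairing_eq_zero_of_mem_ker hx.1 hu hv
  have hV : Module.finrank ℂ (Vsp N) = N + N := by simp
  have heq := Submodule.eq_of_le_of_finrank_eq hle (by
    rw [LinearMap.BilinForm.finrank_orthogonal pairing_nondegenerate, hV, hx.2]; omega)
  have hmem : v ∈ (pairing N).orthogonal (LinearMap.ker (psi x)) := fun u hu => h u hu
  exact hv (heq ▸ hmem : v ∈ LinearMap.ker (psi x))

/-- A pure spinor is recovered, by a Clifford multiplication, from any nonzero `v ⋅ x`. -/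
lemma IsPure.exists_psi_psi_eq {x : ExtE N} (hx : IsPure x) {v : Vsp N} (hv : psi x v ≠ 0) :
    ∃ u ∈ LinearMap.ker (psi x), pairing N u v = 1 ∧ psi (psi x v) u = x := by
  obtain ⟨u, hu, huv⟩ := hx.exists_pairing_ne_zero hv
  have h1 : pairing N ((pairing N u v)⁻¹ • u) v = 1 := by simp [huv]
  have hmem := (LinearMap.ker (psi x)).smul_mem (pairing N u v)⁻¹ hu
  exact ⟨_, hmem, h1, by rw [psi_psi_of_mem_ker hmem, h1, one_smul]⟩

lemma finrank_le_finrank_inf_ker_add_one {V : Type*} [AddCommGroup V] [Module ℂ V]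
    [FiniteDimensional ℂ V] (H : Submodule ℂ V) (f : V →ₗ[ℂ] ℂ) :
    Module.finrank ℂ H ≤ Module.finrank ℂ (H ⊓ LinearMap.ker f : Submodule ℂ V) + 1 := by
  have h1 := Submodule.finrank_sup_add_finrank_inf_eq H (LinearMap.ker f)
  have h2 := LinearMap.finrank_range_add_finrank_ker f
  have h3 := Submodule.finrank_le (H ⊔ LinearMap.ker f)
  have h4 := Submodule.finrank_le (LinearMap.range f)
  rw [Module.finrank_self] at h4
  omega

lemma finrank_add_one_le_of_lt_of_notMem {V : Type*} [AddCommGroup V] [Module ℂ V]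
    [FiniteDimensional ℂ V] {H K : Submodule ℂ V} (hHK : H ≤ K) {v : V} (hK : v ∈ K)
    (hH : v ∉ H) : Module.finrank ℂ H + 1 ≤ Module.finrank ℂ K :=
  Submodule.finrank_lt_finrank_of_lt (lt_of_le_of_ne hHK fun h => hH (h ▸ hK))

/-- `H_x ∩ v^⊥ ⊆ H_{v ⋅ x}`. -/
lemma inf_ker_pairing_le (x : ExtE N) (v : Vsp N) :
    LinearMap.ker (psi x) ⊓ LinearMap.ker (pairing N v) ≤ LinearMap.ker (psi (psi x v)) := by
  rintro u ⟨hu, huv⟩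
  rw [LinearMap.mem_ker, psi_psi_of_mem_ker hu, pairing_comm, LinearMap.mem_ker.1 huv, zero_smul]

lemma IsPure.psi_of_isotropic {x : ExtE N} (hx : IsPure x) {v : Vsp N} (hv : psi x v ≠ 0)
    (hvv : pairing N v v = 0) : IsPure (psi x v) := by
  refine ⟨hv, le_antisymm (finrank_ker_psi_le hv) ?_⟩
  have h1 := finrank_le_finrank_inf_ker_add_one (LinearMap.ker (psi x)) (pairing N v)
  have h2 := finrank_add_one_le_of_lt_of_notMem (inf_ker_pairing_le x v)
    (LinearMap.mem_ker.2 (psi_psi_self_of_isotropic x hvv)) (fun h => hv h.1)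
  rw [hx.2] at h1
  omega

/-- Clifford multiplication by an arbitrary vector preserves purity. -/
lemma IsPure.clifford {x : ExtE N} (hx : IsPure x) {v : Vsp N} (hv : psi x v ≠ 0) :
    IsPure (psi x v) := by
  obtain ⟨u, hu, huv, -⟩ := hx.exists_psi_psi_eq hv
  set w := v - (pairing N v v / 2) • u with hw
  have hwx : psi x w = psi x v := by
    rw [hw, map_sub, map_smul, LinearMap.mem_ker.1 hu, smul_zero, sub_zero]
  have hww : pairing N w w = 0 := by
    have hvu : pairing N v u = 1 := by rw [pairing_comm, huv]
    simp only [hw, map_sub, map_smul, LinearMap.sub_apply, LinearMap.smul_apply, smul_eq_mul,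
      huv, hvu, pairing_eq_zero_of_mem_ker hx.1 hu hu]
    ring
  rw [← hwx] at hv ⊢
  exact hx.psi_of_isotropic hv hww

/-- If a linear combination of pure spinors kills a vector not killed by the first, both are
Clifford multiples of a common pure spinor. -/
lemma IsPure.exists_common_neighbour {a b : ExtE N} (ha : IsPure a) (hb : IsPure b) {v : Vsp N}
    (hv : v ∈ LinearMap.ker (psi (a + b))) (hva : v ∉ LinearMap.ker (psi a)) :
    ∃ w, IsPure w ∧ (∃ s, a = psi w s) ∧ (∃ t, b = psi w t) := by
  have hab : psi b v = -psi a v :=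
    eq_neg_of_add_eq_zero_right ((psi_add a b v).symm.trans hv)
  have hb0 : psi b v ≠ 0 := by rw [hab]; exact neg_ne_zero.2 hva
  obtain ⟨s, -, -, hs⟩ := ha.exists_psi_psi_eq hva
  obtain ⟨t, -, -, ht⟩ := hb.exists_psi_psi_eq hb0
  refine ⟨psi a v, ha.clifford hva, ⟨s, hs.symm⟩, ⟨-t, ?_⟩⟩
  rw [map_neg, ← psi_neg, ← hab, ht]


/-- The splitting of a spinor along `e ⊗ f`. -/
lemma eq_map_add_ι_mul_contractLeft (e : Evec N) (f : Module.Dual ℂ (Evec N)) (x : ExtE N) :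
    x = ExteriorAlgebra.map (LinearMap.id - f.smulRight e) x +
      ExteriorAlgebra.ι ℂ e *
        contractLeft (Q := (0 : QuadraticForm ℂ (Evec N))) f x := by
  induction x using CliffordAlgebra.left_induction with
  | algebraMap r =>
    rw [contractLeft_algebraMap, mul_zero, add_zero]
    exact (AlgHom.commutes (ExteriorAlgebra.map (LinearMap.id - f.smulRight e)) r).symm
  | add x y hx hy =>
    rw [map_add, map_add, mul_add]
    nth_rewrite 1 [hx, hy]
    abel
  | ι_mul x m hx =>
    change ExteriorAlgebra.ι ℂ m * x = ExteriorAlgebra.map _ (ExteriorAlgebra.ι ℂ m * x) +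
      ExteriorAlgebra.ι ℂ e * contractLeft (Q := (0 : QuadraticForm ℂ (Evec N))) f
        (ExteriorAlgebra.ι ℂ m * x)
    rw [ι_mul_contractLeft, map_mul, ExteriorAlgebra.map_apply_ι]
    set y := contractLeft (Q := (0 : QuadraticForm ℂ (Evec N))) f x
    set T := ExteriorAlgebra.map (LinearMap.id - f.smulRight e) x
    have hsq : ExteriorAlgebra.ι ℂ e * x = ExteriorAlgebra.ι ℂ e * T := by
      rw [hx, mul_add, ← mul_assoc, ExteriorAlgebra.ι_sq_zero, zero_mul, add_zero]
    have hanti : ExteriorAlgebra.ι ℂ e * (ExteriorAlgebra.ι ℂ m * y) =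
        -(ExteriorAlgebra.ι ℂ m * (ExteriorAlgebra.ι ℂ e * y)) := by
      rw [← mul_assoc, ← mul_assoc, ← neg_mul,
        eq_neg_of_add_eq_zero_left (ExteriorAlgebra.ι_add_mul_swap e m)]
    have hm : ExteriorAlgebra.ι ℂ m * x =
        ExteriorAlgebra.ι ℂ m * T + ExteriorAlgebra.ι ℂ m * (ExteriorAlgebra.ι ℂ e * y) := by
      rw [← mul_add, ← hx]
    rw [mul_sub, hanti, mul_smul_comm, hsq, hm]
    simp only [LinearMap.sub_apply, LinearMap.id_apply, LinearMap.smulRight_apply, map_sub,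
      map_smul, sub_mul, smul_mul_assoc]
    abel

/-- A spinor killed by all contractions is a scalar. -/
lemma eq_algebraMap_of_contractLeft_eq_zero {x : ExtE N}
    (hx : ∀ f, contractLeft (Q := (0 : QuadraticForm ℂ (Evec N))) (toDualMap N f) x = 0) :
    ∃ c : ℂ, x = algebraMap ℂ (ExtE N) c := by
  classical
  have key : ∀ s : Finset (Fin N), ∃ p : Evec N →ₗ[ℂ] Evec N,
      (∀ e, ∀ i ∈ s, p e i = 0) ∧ ExteriorAlgebra.map p x = x := by
    intro s
    induction s using Finset.induction_on with
    | empty => exact ⟨LinearMap.id, by simp, by simp [ExteriorAlgebra.map_id]⟩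
    | insert i s _ ih =>
      obtain ⟨p, hp, hpx⟩ := ih
      set q : Evec N →ₗ[ℂ] Evec N :=
        LinearMap.id - (toDualMap N (Pi.single i 1)).smulRight (Pi.single i 1) with hq
      refine ⟨q ∘ₗ p, fun e j hj => ?_, ?_⟩
      · by_cases hji : j = i
        · subst hji
          simp [hq, toDualMap_apply]
        · have := hp e j ((Finset.mem_insert.1 hj).resolve_left hji)
          simp [hq, toDualMap_apply, Pi.single_eq_of_ne hji, this]
      · have h := eq_map_add_ι_mul_contractLeft (Pi.single i 1) (toDualMap N (Pi.single i 1)) x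
        rw [hx, mul_zero, add_zero] at h
        rw [← ExteriorAlgebra.map_comp_map, AlgHom.comp_apply, hpx]
        exact h.symm
  obtain ⟨p, hp, h⟩ := key Finset.univ
  have hp0 : p = 0 := by ext e i; simp [hp]
  have hmap : ExteriorAlgebra.map (0 : Evec N →ₗ[ℂ] Evec N) =
      (Algebra.ofId ℂ (ExtE N)).comp ExteriorAlgebra.algebraMapInv := by
    ext e
    simp [ExteriorAlgebra.algebraMapInv]
  refine ⟨ExteriorAlgebra.algebraMapInv x, ?_⟩
  rw [hp0, hmap] at h
  exact h.symm

lemma mem_ker_psi_one {v : Vsp N} : v ∈ LinearMap.ker (psi (1 : ExtE N)) ↔ v.1 = 0 := by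
  rw [LinearMap.mem_ker, psi_apply, mul_one]
  erw [contractLeft_one]
  rw [add_zero, ExteriorAlgebra.ι_eq_zero_iff]

lemma isPure_one : IsPure (1 : ExtE N) := by
  refine ⟨one_ne_zero, ?_⟩
  have : LinearMap.ker (psi (1 : ExtE N)) = LinearMap.ker (LinearMap.fst ℂ (Evec N) (Evec N)) := by
    ext v
    rw [mem_ker_psi_one]
    rfl
  have h := LinearMap.finrank_range_add_finrank_ker (LinearMap.fst ℂ (Evec N) (Evec N))
  rw [LinearMap.range_eq_top.2 LinearMap.fst_surjective, finrank_top] at h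
  simp only [Module.finrank_prod, Module.finrank_fin_fun] at h
  rw [this]
  exact Nat.add_left_cancel h

lemma IsPure.ker_eq_of_le {x y : ExtE N} (hx : IsPure x) (hy : IsPure y)
    (h : LinearMap.ker (psi x) ≤ LinearMap.ker (psi y)) :
    LinearMap.ker (psi x) = LinearMap.ker (psi y) :=
  Submodule.eq_of_le_of_finrank_eq h (hx.2.trans hy.2.symm)

/-- Multiplying `x` by a vector of `H_y \ H_x` brings it closer to `y`. -/
lemma finrank_inf_add_one_le {x y : ExtE N} (hy : y ≠ 0) {z : Vsp N}
    (hzy : z ∈ LinearMap.ker (psi y)) (hzx : z ∉ LinearMap.ker (psi x)) :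
    Module.finrank ℂ (LinearMap.ker (psi x) ⊓ LinearMap.ker (psi y) : Submodule ℂ (Vsp N)) + 1 ≤
      Module.finrank ℂ
        (LinearMap.ker (psi (psi x z)) ⊓ LinearMap.ker (psi y) : Submodule ℂ (Vsp N)) := by
  have hzz := pairing_eq_zero_of_mem_ker hy hzy hzy
  refine finrank_add_one_le_of_lt_of_notMem (le_inf ?_ inf_le_right)
    (v := z) ⟨psi_psi_self_of_isotropic x hzz, hzy⟩ (fun h => hzx h.1)
  rintro u ⟨hux, huy⟩
  exact inf_ker_pairing_le x z ⟨hux, pairing_eq_zero_of_mem_ker hy hzy huy⟩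

lemma IsPure.ker_psi_psi_le {x y : ExtE N} (hx : IsPure x) {z : Vsp N} (hz : psi x z ≠ 0)
    (hzz : pairing N z z = 0) (hxy : LinearMap.ker (psi x) ≤ LinearMap.ker (psi y)) :
    LinearMap.ker (psi (psi x z)) ≤ LinearMap.ker (psi (psi y z)) := by
  have hle : LinearMap.ker (psi x) ⊓ LinearMap.ker (pairing N z) ⊔ Submodule.span ℂ {z} ≤
      LinearMap.ker (psi (psi x z)) := by
    refine sup_le (inf_ker_pairing_le x z) ?_
    rw [Submodule.span_singleton_le_iff_mem]
    exact psi_psi_self_of_isotropic x hzz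
  have h1 := finrank_le_finrank_inf_ker_add_one (LinearMap.ker (psi x)) (pairing N z)
  have h2 := finrank_add_one_le_of_lt_of_notMem
    (le_sup_left : LinearMap.ker (psi x) ⊓ LinearMap.ker (pairing N z) ≤ _)
    (Submodule.mem_sup_right (Submodule.mem_span_singleton_self z)) (fun h => hz h.1)
  have h3 := (hx.psi_of_isotropic hz hzz).2
  rw [hx.2] at h1
  rw [← Submodule.eq_of_le_of_finrank_le hle (by omega)]
  refine sup_le ((inf_le_inf_right _ hxy).trans (inf_ker_pairing_le y z)) ?_
  rw [Submodule.span_singleton_le_iff_mem]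
  exact psi_psi_self_of_isotropic y hzz

/-- The annihilator determines a pure spinor up to a scalar. -/
lemma IsPure.exists_smul_eq {x y : ExtE N} (hx : IsPure x)
    (hxy : LinearMap.ker (psi x) ≤ LinearMap.ker (psi y)) : ∃ c : ℂ, y = c • x := by
  obtain ⟨k, hk⟩ : ∃ k, N ≤ Module.finrank ℂ
      (LinearMap.ker (psi x) ⊓ LinearMap.ker (psi (1 : ExtE N)) : Submodule ℂ (Vsp N)) + k :=
    ⟨N, Nat.le_add_left _ _⟩
  induction k generalizing x y with
  | zero =>
    have h1 := Submodule.eq_of_le_of_finrank_le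
      (inf_le_right : LinearMap.ker (psi x) ⊓ LinearMap.ker (psi (1 : ExtE N)) ≤ _)
      (by rw [isPure_one.2]; exact hk)
    have hle : LinearMap.ker (psi (1 : ExtE N)) ≤ LinearMap.ker (psi x) := inf_eq_right.1 h1
    have hscalar : ∀ w : ExtE N, LinearMap.ker (psi (1 : ExtE N)) ≤ LinearMap.ker (psi w) →
        ∃ c : ℂ, w = algebraMap ℂ (ExtE N) c := by
      refine fun w hw => eq_algebraMap_of_contractLeft_eq_zero fun f => ?_
      have h := LinearMap.mem_ker.1 (hw (mem_ker_psi_one (v := ((0, f) : Vsp N)).2 rfl))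
      simpa [psi_apply] using h
    obtain ⟨c, rfl⟩ := hscalar x hle
    obtain ⟨d, rfl⟩ := hscalar y (hle.trans hxy)
    have hc : c ≠ 0 := by
      rintro rfl
      exact hx.1 (map_zero _)
    exact ⟨d / c, by rw [Algebra.smul_def, ← map_mul, div_mul_cancel₀ d hc]⟩
  | succ k ih =>
    by_cases hle : LinearMap.ker (psi (1 : ExtE N)) ≤ LinearMap.ker (psi x)
    · exact ih hx hxy (by rw [inf_eq_right.2 hle, isPure_one.2]; omega)
    · obtain ⟨z, hz1, hzx⟩ := SetLike.not_le_iff_exists.1 hle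
      have hzz := pairing_eq_zero_of_mem_ker one_ne_zero hz1 hz1
      have hstep := finrank_inf_add_one_le one_ne_zero hz1 hzx
      obtain ⟨c, hc⟩ := ih (hx.psi_of_isotropic hzx hzz) (hx.ker_psi_psi_le hzx hzz hxy) (by omega)
      obtain ⟨u, hu, huz, hux⟩ := hx.exists_psi_psi_eq hzx
      refine ⟨c, ?_⟩
      have huy := psi_psi_of_mem_ker (hxy hu) z
      rw [huz, one_smul, hc, psi_smul, hux] at huy
      exact huy.symm

lemma psi_involute (x : ExtE N) (v : Vsp N) :
    psi (involute (Q := (0 : QuadraticForm ℂ (Evec N))) x) v =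
      -involute (Q := (0 : QuadraticForm ℂ (Evec N))) (psi x v) := by
  have hc : ∀ d : Module.Dual ℂ (Evec N),
      contractLeft (Q := (0 : QuadraticForm ℂ (Evec N))) d (involute x) =
        -involute (contractLeft (Q := (0 : QuadraticForm ℂ (Evec N))) d x) := by
    intro d
    induction x using CliffordAlgebra.left_induction with
    | algebraMap r => simp
    | add x y hx hy => rw [map_add, map_add, map_add, hx, hy, map_add, neg_add]
    | ι_mul x m hx =>
      rw [map_mul, involute_ι, neg_mul, map_neg, contractLeft_ι_mul, hx, contractLeft_ι_mul,
        map_sub, map_smul, map_mul, involute_ι]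
      simp
  rw [psi_apply, psi_apply, map_add, map_mul, neg_add, hc]
  erw [involute_ι]
  rw [neg_mul, neg_neg]

lemma mem_evenPart_iff {x : ExtE N} :
    x ∈ evenPart N ↔ involute (Q := (0 : QuadraticForm ℂ (Evec N))) x = x := by
  refine ⟨fun h => involute_eq_of_mem_even h, fun h => ?_⟩
  have hx : x ∈ evenOdd (0 : QuadraticForm ℂ (Evec N)) 0 ⊔
      evenOdd (0 : QuadraticForm ℂ (Evec N)) 1 := by
    rw [(evenOdd_isCompl _).sup_eq_top]
    trivial
  obtain ⟨y, hy, z, hz, rfl⟩ := Submodule.mem_sup.1 hx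
  rw [map_add, involute_eq_of_mem_even hy, involute_eq_of_mem_odd hz, add_right_inj,
    neg_eq_iff_add_eq_zero, ← two_smul ℂ] at h
  rw [(smul_eq_zero.1 h).resolve_left two_ne_zero, add_zero]
  exact hy

lemma involute_psi_of_mem_evenPart {x : ExtE N} (hx : x ∈ evenPart N) (v : Vsp N) :
    involute (Q := (0 : QuadraticForm ℂ (Evec N))) (psi x v) = -psi x v := by
  rw [← neg_eq_iff_eq_neg, ← psi_involute, mem_evenPart_iff.1 hx]

lemma psi_psi_mem_evenPart {x : ExtE N} (hx : x ∈ evenPart N) (u v : Vsp N) :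
    psi (psi x u) v ∈ evenPart N := by
  rw [mem_evenPart_iff, ← neg_neg (involute _), ← psi_involute, involute_psi_of_mem_evenPart hx,
    psi_neg, neg_neg]

lemma psi_ne_smul_of_mem_evenPart {a b : ExtE N} (ha : a ∈ evenPart N) (hb : b ∈ evenPart N)
    (hb0 : b ≠ 0) (v : Vsp N) (c : ℂ) : b ≠ c • psi a v := by
  intro h
  have hi := mem_evenPart_iff.1 hb
  rw [h, map_smul, involute_psi_of_mem_evenPart ha, smul_neg, ← h, neg_eq_iff_add_eq_zero,
    ← two_smul ℂ] at hi
  exact hb0 ((smul_eq_zero.1 hi).resolve_left two_ne_zero)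

/-- Two even pure spinors in `V ⋅ w` span a line of the spinor variety. -/
lemma lineIn_of_common_neighbour {a b w : ExtE N} (ha : purespinor a) (hb : purespinor b)
    (hw : IsPure w) {s t : Vsp N} (has : a = psi w s) (hbt : b = psi w t) :
    lineIn (SpinorVariety N) (Projectivization.mk ℂ a ha.1) (Projectivization.mk ℂ b hb.1) := by
  intro r hr
  induction r using Projectivization.ind with
  | h x hx =>
    rw [Projectivization.submodule_mk, Projectivization.submodule_mk,
      Projectivization.submodule_mk, Submodule.span_singleton_le_iff_mem,
      ← Submodule.span_union, Set.singleton_union, Submodule.mem_span_pair] at hr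
    obtain ⟨α, β, rfl⟩ := hr
    refine ⟨_, hx, ⟨hx, Submodule.add_mem _ (Submodule.smul_mem _ _ ha.2.1)
      (Submodule.smul_mem _ _ hb.2.1), ?_⟩, rfl⟩
    have hz : α • a + β • b = psi w (α • s + β • t) := by
      rw [map_add, map_smul, map_smul, has, hbt]
    rw [hz] at hx ⊢
    exact (hw.clifford hx).2

lemma mk_mem_spinorVariety {a : ExtE N} (ha : purespinor a) :
    Projectivization.mk ℂ a ha.1 ∈ SpinorVariety N := ⟨a, ha.1, ha, rfl⟩

lemma purespinor_of_mk_mem {a : ExtE N} (ha : a ≠ 0)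
    (h : Projectivization.mk ℂ a ha ∈ SpinorVariety N) : purespinor a := by
  obtain ⟨b, hb0, hb, hab⟩ := h
  obtain ⟨c, rfl⟩ := (Projectivization.mk_eq_mk_iff' ℂ _ _ _ _).1 hab
  have hc : c ≠ 0 := by
    rintro rfl
    simp at ha
  exact ⟨ha, Submodule.smul_mem _ _ hb.2.1, by rw [ker_psi_smul hc, hb.2.2]⟩

lemma chainDist_zero {K V : Type*} [DivisionRing K] [AddCommGroup V] [Module K V]
    {X : Set (Projectivization K V)} {p : Projectivization K V} (hp : p ∈ X) :
    chainDist X p p 0 :=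
  ⟨fun _ => p, rfl, rfl, fun _ _ => hp, fun _ h => absurd h (Nat.not_lt_zero _)⟩

lemma chainDist_succ_iff {K V : Type*} [DivisionRing K] [AddCommGroup V] [Module K V]
    {X : Set (Projectivization K V)} {p q : Projectivization K V} {r : ℕ} :
    chainDist X p q (r + 1) ↔ p ∈ X ∧ ∃ p', lineIn X p p' ∧ chainDist X p' q r := by
  constructor
  · rintro ⟨c, rfl, hq, hX, hl⟩
    exact ⟨hX 0 (Nat.zero_le _), c 1, hl 0 r.succ_pos, fun i => c (i + 1), rfl, hq,
      fun i hi => hX _ (by omega), fun i hi => hl _ (by omega)⟩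
  · rintro ⟨hp, p', hpp', c, rfl, hq, hX, hl⟩
    refine ⟨fun i => Nat.casesOn i p c, rfl, hq, ?_, ?_⟩
    · rintro (_ | i) hi
      exacts [hp, hX i (by omega)]
    · rintro (_ | i) hi
      exacts [hpp', hl i (by omega)]

lemma lineIn_self {K V : Type*} [DivisionRing K] [AddCommGroup V] [Module K V]
    {X : Set (Projectivization K V)} {p : Projectivization K V} (hp : p ∈ X) : lineIn X p p := by
  intro r hr
  rw [sup_idem] at hr
  have h := Submodule.eq_of_le_of_finrank_eq hr
    (r.finrank_submodule.trans p.finrank_submodule.symm)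
  rwa [Projectivization.submodule_injective h]

lemma IsPure.finrank_inf_add_finrank_inf_le (x z : ExtE N) {y : ExtE N} (hy : IsPure y) :
    Module.finrank ℂ (LinearMap.ker (psi x) ⊓ LinearMap.ker (psi y) : Submodule ℂ (Vsp N)) +
      Module.finrank ℂ (LinearMap.ker (psi y) ⊓ LinearMap.ker (psi z) : Submodule ℂ (Vsp N)) ≤
      Module.finrank ℂ (LinearMap.ker (psi x) ⊓ LinearMap.ker (psi z) : Submodule ℂ (Vsp N)) +
        N := by
  rw [← Submodule.finrank_sup_add_finrank_inf_eq, add_comm]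
  refine add_le_add (Submodule.finrank_mono ?_) ((Submodule.finrank_mono ?_).trans_eq hy.2)
  · exact le_inf (inf_le_left.trans inf_le_left) (inf_le_right.trans inf_le_right)
  · exact sup_le inf_le_right inf_le_left

lemma IsPure.le_finrank_inf_psi_add_one {x : ExtE N} (hx : IsPure x) (v : Vsp N) :
    N ≤ Module.finrank ℂ
      (LinearMap.ker (psi x) ⊓ LinearMap.ker (psi (psi x v)) : Submodule ℂ (Vsp N)) + 1 := by
  have h1 := finrank_le_finrank_inf_ker_add_one (LinearMap.ker (psi x)) (pairing N v)
  have h2 := Submodule.finrank_mono (le_inf inf_le_left (inf_ker_pairing_le x v))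
  rw [hx.2] at h1
  omega

/-- Annihilators of points on a common line of the spinor variety meet in codimension at most
two. -/
lemma le_finrank_inf_add_two_of_lineIn {a b : ExtE N} (ha : purespinor a) (hb : purespinor b)
    (h : lineIn (SpinorVariety N) (Projectivization.mk ℂ a ha.1)
      (Projectivization.mk ℂ b hb.1)) :
    N ≤ Module.finrank ℂ
      (LinearMap.ker (psi a) ⊓ LinearMap.ker (psi b) : Submodule ℂ (Vsp N)) + 2 := by
  by_cases hle : LinearMap.ker (psi (a + b)) ≤ LinearMap.ker (psi a)
  · have hab : LinearMap.ker (psi a) ≤ LinearMap.ker (psi (a + b)) := by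
      by_cases h0 : a + b = 0
      · intro v _
        rw [h0]
        exact psi_zero v
      · have hpure : purespinor (a + b) := purespinor_of_mk_mem h0 (h _ (by
          rw [Projectivization.submodule_mk, Projectivization.submodule_mk,
            Projectivization.submodule_mk, Submodule.span_singleton_le_iff_mem]
          exact Submodule.add_mem_sup (Submodule.mem_span_singleton_self a)
            (Submodule.mem_span_singleton_self b)))
        exact (hpure.isPure.ker_eq_of_le ha.isPure hle).ge
    have hle' : LinearMap.ker (psi a) ≤ LinearMap.ker (psi b) := by
      intro v hv
      have hv' := LinearMap.mem_ker.1 (hab hv)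
      rwa [psi_add, LinearMap.mem_ker.1 hv, zero_add] at hv'
    rw [inf_eq_left.2 hle', ha.2.2]
    omega
  · obtain ⟨v, hv, hva⟩ := SetLike.not_le_iff_exists.1 hle
    have hab : psi b v = -psi a v := eq_neg_of_add_eq_zero_right ((psi_add a b v).symm.trans hv)
    have h1 := ha.isPure.le_finrank_inf_psi_add_one v
    have h2 := hb.isPure.le_finrank_inf_psi_add_one v
    have h3 := (ha.isPure.clifford hva).finrank_inf_add_finrank_inf_le a b
    rw [hab, ← neg_one_smul ℂ, ker_psi_smul (by norm_num), inf_comm] at h2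
    omega

/-- The distance formula: `[a]` and `[b]` are joined by `r` lines exactly when
`dim (H_a ∩ H_b) ≥ N - 2 r`. -/
lemma chainDist_iff {a b : ExtE N} (ha : purespinor a) (hb : purespinor b) (r : ℕ) :
    chainDist (SpinorVariety N) (Projectivization.mk ℂ a ha.1) (Projectivization.mk ℂ b hb.1) r ↔
      N ≤ Module.finrank ℂ
        (LinearMap.ker (psi a) ⊓ LinearMap.ker (psi b) : Submodule ℂ (Vsp N)) + 2 * r := by
  induction r generalizing a with
  | zero =>
    constructor
    · rintro ⟨c, h0, h1, -⟩
      obtain ⟨u, rfl⟩ := (Projectivization.mk_eq_mk_iff' ℂ _ _ _ _).1 (h0.symm.trans h1)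
      have hu : u ≠ 0 := by
        rintro rfl
        exact ha.1 (zero_smul _ _)
      rw [ker_psi_smul hu, inf_idem, hb.2.2, mul_zero, add_zero]
    · intro h
      have h1 := Submodule.eq_of_le_of_finrank_le
        (inf_le_right : LinearMap.ker (psi a) ⊓ LinearMap.ker (psi b) ≤ _)
        (by rw [hb.2.2]; exact h)
      obtain ⟨c, hc⟩ := hb.isPure.exists_smul_eq (inf_eq_right.1 h1)
      rw [(Projectivization.mk_eq_mk_iff' ℂ _ _ ha.1 hb.1).2 ⟨c, hc.symm⟩]
      exact chainDist_zero (mk_mem_spinorVariety hb)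
  | succ r ih =>
    rw [chainDist_succ_iff]
    constructor
    · rintro ⟨-, p, hl, hp⟩
      induction p using Projectivization.ind with
      | h x hx =>
        have hx' : purespinor x := by
          obtain ⟨c, h0, -, hX, -⟩ := hp
          exact purespinor_of_mk_mem hx (h0 ▸ hX 0 (Nat.zero_le _))
        have h1 := (ih hx').1 hp
        have h2 := le_finrank_inf_add_two_of_lineIn ha hx' hl
        have h3 := hx'.isPure.finrank_inf_add_finrank_inf_le a b
        omega
    · intro h
      refine ⟨mk_mem_spinorVariety ha, ?_⟩
      by_cases hba : LinearMap.ker (psi b) ≤ LinearMap.ker (psi a)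
      · refine ⟨_, lineIn_self (mk_mem_spinorVariety ha), (ih ha).2 ?_⟩
        rw [inf_eq_right.2 hba, hb.2.2]
        omega
      obtain ⟨z, hzb, hza⟩ := SetLike.not_le_iff_exists.1 hba
      have hw := ha.isPure.clifford hza
      have h1 := finrank_inf_add_one_le hb.1 hzb hza
      have hbw : ¬ LinearMap.ker (psi b) ≤ LinearMap.ker (psi (psi a z)) := by
        intro hle
        obtain ⟨c, hc⟩ := hw.exists_smul_eq (hb.isPure.ker_eq_of_le hw hle).ge
        exact psi_ne_smul_of_mem_evenPart ha.2.1 hb.2.1 hb.1 z c hc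
      obtain ⟨t, htb, htw⟩ := SetLike.not_le_iff_exists.1 hbw
      have hy := hw.clifford htw
      have h2 := finrank_inf_add_one_le hb.1 htb htw
      have hy' : purespinor (psi (psi a z) t) :=
        ⟨hy.1, psi_psi_mem_evenPart ha.2.1 z t, hy.2⟩
      obtain ⟨s, -, -, hs⟩ := ha.isPure.exists_psi_psi_eq hza
      exact ⟨_, lineIn_of_common_neighbour ha hy' hw hs.symm rfl, (ih hy').2 (by omega)⟩

/-- On a bisecant line at distance at least two, `H_{a+b} = H_a ∩ H_b`. -/
lemma ker_psi_add_eq_inf {a b : ExtE N} (ha : purespinor a) (hb : purespinor b)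
    (hab : 2 ≤ hdist (SpinorVariety N) (Projectivization.mk ℂ a ha.1)
      (Projectivization.mk ℂ b hb.1)) :
    LinearMap.ker (psi (a + b)) = LinearMap.ker (psi a) ⊓ LinearMap.ker (psi b) := by
  apply le_antisymm
  · have hle : LinearMap.ker (psi (a + b)) ≤ LinearMap.ker (psi a) := by
      intro v hv
      by_contra hva
      obtain ⟨w, hw, ⟨s, hs⟩, t, ht⟩ := ha.isPure.exists_common_neighbour hb.isPure hv hva
      have hchain : chainDist (SpinorVariety N) (Projectivization.mk ℂ a ha.1)
          (Projectivization.mk ℂ b hb.1) 1 :=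
        chainDist_succ_iff.2 ⟨mk_mem_spinorVariety ha, _,
          lineIn_of_common_neighbour ha hb hw hs ht, chainDist_zero (mk_mem_spinorVariety hb)⟩
      have h1 : hdist (SpinorVariety N) (Projectivization.mk ℂ a ha.1)
          (Projectivization.mk ℂ b hb.1) ≤ 1 := Nat.sInf_le hchain
      omega
    refine le_inf hle fun v hv => ?_
    have hv' := LinearMap.mem_ker.1 hv
    rwa [psi_add, LinearMap.mem_ker.1 (hle hv), zero_add] at hv'
  · rintro v ⟨hva, hvb⟩
    rw [LinearMap.mem_ker, psi_add, LinearMap.mem_ker.1 hva, LinearMap.mem_ker.1 hvb, add_zero]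

end Clifford

/-- For a point `[a + b]` on a bisecant line to `S_N^+` with
`d([a],[b]) ≥ 2`, the isotropic kernel of `a + b` equals `H_a ∩ H_b`; consequently any
two such decompositions of the same point involve pairs at the same Hamming distance. -/
theorem stmt11 (N : ℕ) (hN : Even N)
    (a b : ExtE N) (ha : purespinor a) (hb : purespinor b)
    (hab : 2 ≤ hdist (SpinorVariety N) (Projectivization.mk ℂ a ha.1)
      (Projectivization.mk ℂ b hb.1)) :
    LinearMap.ker (psi (a + b)) = LinearMap.ker (psi a) ⊓ LinearMap.ker (psi b) ∧
    (∀ (c d : ExtE N) (hc : purespinor c) (hd : purespinor d),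
      2 ≤ hdist (SpinorVariety N) (Projectivization.mk ℂ c hc.1)
        (Projectivization.mk ℂ d hd.1) →
      ∀ lam : ℂ, lam ≠ 0 → a + b = lam • (c + d) →
      hdist (SpinorVariety N) (Projectivization.mk ℂ a ha.1)
          (Projectivization.mk ℂ b hb.1) =
        hdist (SpinorVariety N) (Projectivization.mk ℂ c hc.1)
          (Projectivization.mk ℂ d hd.1)) := by
  refine ⟨ker_psi_add_eq_inf ha hb hab, fun c d hc hd hcd lam hlam h => ?_⟩
  have hker : LinearMap.ker (psi a) ⊓ LinearMap.ker (psi b) =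
      LinearMap.ker (psi c) ⊓ LinearMap.ker (psi d) := by
    rw [← ker_psi_add_eq_inf ha hb hab, ← ker_psi_add_eq_inf hc hd hcd, h, ker_psi_smul hlam]
  unfold hdist
  simp only [chainDist_iff, ha, hb, hc, hd]
  rw [hker]
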